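/- arXiv:2212.13278 — 3 statements merged into one kernel-verified Lean document; each statement's English description precedes it below -/
import Mathlib

section
/- Let E be a finite-dimensional real inner product space, T ⊆ E a subspace, and P_T, P_{T⊥} the orthogonal projections onto T and its orthogonal complement. Let z, ẑ, v ∈ E and let g, a ≥ 0 and μ, L > 0 be reals satisfying: (i) ⟨v, z − ẑ⟩ ≥ g − (μ/8)·a; (ii) g ≥ μ·a; (iii) ‖v‖ ≤ L; (iv) ‖P_{T⊥}(z − ẑ)‖ ≤ (1/(8L))·max{g, μ·a}. Then ⟨P_T v, z − ẑ⟩ ≥ (3/4)·max{g, μ·a}. Moreover, if in addition ‖z − ẑ‖ ≤ a and a > 0, then ‖P_T v‖ ≥ (3/4)μ. -/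
open scoped RealInnerProductSpace

/-- Abstract aiming lemma: the projected subgradient points towards the solution set. -/
theorem stmt_2 {E : Type*} [NormedAddCommGroup E] [InnerProductSpace ℝ E]
    [FiniteDimensional ℝ E] (T : Submodule ℝ E)
    (z zhat v : E) (g a μ L : ℝ)
    (hg : 0 ≤ g) (ha : 0 ≤ a) (hμ : 0 < μ) (hL : 0 < L)
    (h1 : ⟪v, z - zhat⟫ ≥ g - μ / 8 * a)
    (h2 : g ≥ μ * a)
    (h3 : ‖v‖ ≤ L)
    (h4 : ‖(Submodule.orthogonalProjectionOnto Tᗮ (z - zhat) : E)‖ ≤ (1 / (8 * L)) * max g (μ * a)) :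
    ⟪(Submodule.orthogonalProjectionOnto T v : E), z - zhat⟫ ≥ (3 / 4) * max g (μ * a) ∧
      (‖z - zhat‖ ≤ a → 0 < a → ‖(Submodule.orthogonalProjectionOnto T v : E)‖ ≥ (3 / 4) * μ) := by
  rw [max_eq_left h2] at *
  have key : ⟪(Submodule.orthogonalProjectionOnto T v : E), z - zhat⟫ ≥ (3 / 4) * g := by
    have e1 : ⟪(Submodule.orthogonalProjectionOnto T v : E), z - zhat⟫
        = ⟪v, (Submodule.orthogonalProjectionOnto T (z - zhat) : E)⟫ :=
      Submodule.inner_starProjection_left_eq_right T v (z - zhat)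
    have e2 : (Submodule.orthogonalProjectionOnto T (z - zhat) : E)
        + (Submodule.orthogonalProjectionOnto Tᗮ (z - zhat) : E) = z - zhat :=
      Submodule.starProjection_add_starProjection_orthogonal (K := T) (z - zhat)
    have e3 := real_inner_le_norm v (Submodule.orthogonalProjectionOnto Tᗮ (z - zhat) : E)
    have e4 := mul_le_mul h3 h4 (norm_nonneg _) hL.le
    have e5 : L * (1 / (8 * L) * g) = g / 8 := by field_simp
    have e6 := congrArg (fun w => ⟪v, w⟫) e2
    simp only [inner_add_right] at e6
    rw [e1]
    linarith
  refine ⟨key, fun hz hpos => ?_⟩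
  have f1 := real_inner_le_norm (Submodule.orthogonalProjectionOnto T v : E) (z - zhat)
  have f2 := mul_le_mul_of_nonneg_left hz
    (norm_nonneg (Submodule.orthogonalProjectionOnto T v : E))
  have f3 : (3 / 4 * μ) * a ≤ ‖(Submodule.orthogonalProjectionOnto T v : E)‖ * a := by
    linarith
  exact le_of_mul_le_mul_right f3 hpos
end

section
/- Let E be a finite-dimensional real inner product space, T ⊆ E a subspace, and P_T the orthogonal projection onto T. Let z, ẑ, v ∈ E and reals g, a ≥ 0, μ, L > 0, γ satisfy: (i) ‖z − ẑ‖ ≤ a; (ii) ⟨P_T v, z − ẑ⟩ ≥ (3/4)·g; (iii) g ≥ μ·a; (iv) 0 < ‖P_T v‖ ≤ L; (v) g/(2‖P_T v‖²) ≤ γ ≤ g/‖P_T v‖². Then ‖z − γ·P_T v − ẑ‖² ≤ (1 − μ²/(2L²))·a². -/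
open scoped RealInnerProductSpace

/-- Abstract contraction step of the one-step improvement lemma. -/
theorem stmt_3 {E : Type*} [NormedAddCommGroup E] [InnerProductSpace ℝ E]
    [FiniteDimensional ℝ E] (T : Submodule ℝ E)
    (z zhat v : E) (g a μ L γ : ℝ)
    (hg : 0 ≤ g) (ha : 0 ≤ a) (hμ : 0 < μ) (hL : 0 < L)
    (h1 : ‖z - zhat‖ ≤ a)
    (h2 : ⟪(Submodule.orthogonalProjectionOnto T v : E), z - zhat⟫ ≥ (3 / 4) * g)
    (h3 : g ≥ μ * a)
    (h4 : 0 < ‖(Submodule.orthogonalProjectionOnto T v : E)‖)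
    (h4' : ‖(Submodule.orthogonalProjectionOnto T v : E)‖ ≤ L)
    (h5 : g / (2 * ‖(Submodule.orthogonalProjectionOnto T v : E)‖ ^ 2) ≤ γ)
    (h5' : γ ≤ g / ‖(Submodule.orthogonalProjectionOnto T v : E)‖ ^ 2) :
    ‖z - γ • (Submodule.orthogonalProjectionOnto T v : E) - zhat‖ ^ 2 ≤ (1 - μ ^ 2 / (2 * L ^ 2)) * a ^ 2 := by
  generalize (Submodule.orthogonalProjectionOnto T v : E) = p at *
  have hp2 : 0 < ‖p‖ ^ 2 := by positivity
  have hγ : 0 ≤ γ := le_trans (by positivity) h5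
  have e : z - γ • p - zhat = (z - zhat) - γ • p := by abel
  rw [e, norm_sub_sq_real, norm_smul, inner_smul_right, real_inner_comm, mul_pow,
    Real.norm_eq_abs, sq_abs]
  have hd : ‖z - zhat‖ ^ 2 ≤ a ^ 2 := pow_le_pow_left₀ (norm_nonneg _) h1 2
  have hi : γ * ((3 / 4) * g) ≤ γ * ⟪p, z - zhat⟫ := mul_le_mul_of_nonneg_left h2 hγ
  obtain ⟨q, hq⟩ : ∃ q, q = g / ‖p‖ ^ 2 := ⟨_, rfl⟩
  have hgq : g = q * ‖p‖ ^ 2 := by rw [hq]; field_simp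
  have h5a : q / 2 ≤ γ := by
    refine le_trans (le_of_eq ?_) h5
    rw [hq]; field_simp
  rw [← hq] at h5'
  have hk : (γ - q / 2) * (q - γ) * ‖p‖ ^ 2 ≥ 0 :=
    mul_nonneg (mul_nonneg (by linarith) (by linarith)) hp2.le
  have hk' : γ ^ 2 * ‖p‖ ^ 2 - 3 / 2 * (γ * g) ≤ - (g ^ 2 / ‖p‖ ^ 2 / 2) := by
    have : g ^ 2 / ‖p‖ ^ 2 = q ^ 2 * ‖p‖ ^ 2 := by rw [hq]; field_simp
    rw [this, hgq]
    linarith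
  have hm : (μ * a) ^ 2 / L ^ 2 ≤ g ^ 2 / ‖p‖ ^ 2 := by
    have : 0 ≤ μ * a := by positivity
    gcongr
  have hr : (1 - μ ^ 2 / (2 * L ^ 2)) * a ^ 2 = a ^ 2 - (μ * a) ^ 2 / L ^ 2 / 2 := by
    field_simp
  rw [hr]
  linarith
end

section
/- Let E be a finite-dimensional real inner product space, T ⊆ E a subspace, and P_T the orthogonal projection onto T. Let z, z₊, ẑ, v ∈ E and reals g, a ≥ 0, μ, L > 0, γ, C ≥ 0 satisfy: (i) ‖z − ẑ‖ ≤ a; (ii) ⟨P_T v, z − ẑ⟩ ≥ (3/4)·g; (iii) g ≥ μ·a; (iv) 0 < ‖P_T v‖ ≤ L; (v) g/(2‖P_T v‖²) ≤ γ ≤ g/‖P_T v‖²; (vi) ‖z₊ − (z − γ·P_T v)‖ ≤ C·a². Then ‖z₊ − ẑ‖ ≤ (1 − μ²/(2L²))^{1/2}·a + C·a². -/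
open scoped RealInnerProductSpace

/-- Full one-step improvement lemma in abstract form. -/
theorem stmt_4 {E : Type*} [NormedAddCommGroup E] [InnerProductSpace ℝ E]
    [FiniteDimensional ℝ E] (T : Submodule ℝ E)
    (z zplus zhat v : E) (g a μ L γ C : ℝ)
    (hg : 0 ≤ g) (ha : 0 ≤ a) (hμ : 0 < μ) (hL : 0 < L) (hC : 0 ≤ C)
    (h1 : ‖z - zhat‖ ≤ a)
    (h2 : ⟪(Submodule.orthogonalProjectionOnto T v : E), z - zhat⟫ ≥ (3 / 4) * g)
    (h3 : g ≥ μ * a)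
    (h4 : 0 < ‖(Submodule.orthogonalProjectionOnto T v : E)‖)
    (h4' : ‖(Submodule.orthogonalProjectionOnto T v : E)‖ ≤ L)
    (h5 : g / (2 * ‖(Submodule.orthogonalProjectionOnto T v : E)‖ ^ 2) ≤ γ)
    (h5' : γ ≤ g / ‖(Submodule.orthogonalProjectionOnto T v : E)‖ ^ 2)
    (h6 : ‖zplus - (z - γ • (Submodule.orthogonalProjectionOnto T v : E))‖ ≤ C * a ^ 2) :
    ‖zplus - zhat‖ ≤ (1 - μ ^ 2 / (2 * L ^ 2)) ^ ((1 : ℝ) / 2) * a + C * a ^ 2 := by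
  generalize (Submodule.orthogonalProjectionOnto T v : E) = p at *
  have hq : 0 < ‖p‖ ^ 2 := by positivity
  have hqL : ‖p‖ ^ 2 ≤ L ^ 2 := by gcongr
  have e1 : g ≤ γ * (2 * ‖p‖ ^ 2) := (div_le_iff₀ (by positivity)).1 h5
  have e2 : γ * ‖p‖ ^ 2 ≤ g := (le_div_iff₀ hq).1 h5'
  have hγ : 0 ≤ γ := le_trans (by positivity) h5
  have hn : ‖z - zhat - γ • p‖ ^ 2
      = ‖z - zhat‖ ^ 2 - 2 * (γ * ⟪p, z - zhat⟫) + γ ^ 2 * ‖p‖ ^ 2 := by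
    rw [norm_sub_sq_real, real_inner_smul_right, real_inner_comm, norm_smul, mul_pow,
      Real.norm_eq_abs, sq_abs]
  have hz : ‖z - zhat‖ ^ 2 ≤ a ^ 2 := by gcongr
  have hi : γ * (3 / 4 * g) ≤ γ * ⟪p, z - zhat⟫ := mul_le_mul_of_nonneg_left h2 hγ
  have hk : γ ^ 2 * ‖p‖ ^ 2 - 3 / 2 * γ * g ≤ -(g ^ 2 / (2 * ‖p‖ ^ 2)) := by
    rw [← neg_div, le_div_iff₀ (by positivity)]
    nlinarith [mul_nonneg (sub_nonneg.2 e2) (sub_nonneg.2 e1)]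
  have hm : (μ * a) ^ 2 / (2 * L ^ 2) ≤ g ^ 2 / (2 * ‖p‖ ^ 2) := by gcongr
  have hr : (1 - μ ^ 2 / (2 * L ^ 2)) * a ^ 2 = a ^ 2 - (μ * a) ^ 2 / (2 * L ^ 2) := by ring
  have hs : ‖z - zhat - γ • p‖ ≤ (1 - μ ^ 2 / (2 * L ^ 2)) ^ ((1 : ℝ) / 2) * a := by
    rw [← Real.sqrt_eq_rpow]
    nth_rewrite 1 [← Real.sqrt_sq ha]
    rw [← Real.sqrt_mul' _ (sq_nonneg a)]
    apply Real.le_sqrt_of_sq_le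
    rw [hn, hr]
    linarith
  have ht : zplus - zhat = (z - zhat - γ • p) + (zplus - (z - γ • p)) := by abel
  rw [ht]
  exact (norm_add_le _ _).trans (add_le_add hs h6)
end
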